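/- Let Ĝ be a graph with maximal spectral radius in Bl(k,φ). If B and B' are two blocks of Ĝ each having at least 4 vertices, then B and B' are not adjacent, i.e., they do not share a cut vertex. -/

import Mathlib

namespace SpectralBlock

variable {V : Type*}

open Classical in
/-- The real adjacency matrix of a simple graph. -/
noncomputable def adjMat [Fintype V] (G : SimpleGraph V) : Matrix V V ℝ :=
  Matrix.of fun u v => if G.Adj u v then (1 : ℝ) else 0

/-- The spectral radius of a graph: the largest real eigenvalue of its adjacency matrix. -/
noncomputable def specRad [Fintype V] (G : SimpleGraph V) : ℝ :=
  sSup {r : ℝ | ∃ x : V → ℝ, x ≠ 0 ∧ (adjMat G).mulVec x = r • x}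

/-- A Perron vector of `G`: an entrywise positive eigenvector of the adjacency
matrix for the eigenvalue `specRad G`. -/
def IsPerron [Fintype V] (G : SimpleGraph V) (x : V → ℝ) : Prop :=
  (∀ v, 0 < x v) ∧ (adjMat G).mulVec x = specRad G • x

/-- A dissociation set: a set of vertices inducing a subgraph of maximum degree at most 1. -/
def IsDissoc (G : SimpleGraph V) (D : Set V) : Prop :=
  ∀ v ∈ D, (D ∩ {u | G.Adj v u}).ncard ≤ 1

/-- The dissociation number: the maximum cardinality of a dissociation set. -/
noncomputable def dissocNum [Fintype V] (G : SimpleGraph V) : ℕ :=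
  sSup {n : ℕ | ∃ D : Set V, IsDissoc G D ∧ D.ncard = n}

/-- A maximum dissociation set. -/
def IsMaxDissoc [Fintype V] (G : SimpleGraph V) (D : Set V) : Prop :=
  IsDissoc G D ∧ D.ncard = dissocNum G

/-- A cut vertex of a connected graph: a vertex whose removal disconnects the graph. -/
def IsCutVertex (G : SimpleGraph V) (v : V) : Prop :=
  G.Connected ∧ ¬ ((⊤ : G.Subgraph).deleteVerts {v}).coe.Connected

/-- A block of a graph, viewed as a set of vertices: a maximal set inducing a
connected subgraph having no cut vertex of its own. -/
def IsBlock (G : SimpleGraph V) (B : Set V) : Prop :=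
  (G.induce B).Connected ∧ (∀ v, ¬ IsCutVertex (G.induce B) v) ∧
    ∀ C : Set V, B ⊆ C → (G.induce C).Connected →
      (∀ v, ¬ IsCutVertex (G.induce C) v) → B = C

/-- A pendant block: a block containing at most one cut vertex of the graph. -/
def IsPendantBlock (G : SimpleGraph V) (B : Set V) : Prop :=
  IsBlock G B ∧ {v | v ∈ B ∧ IsCutVertex G v}.Subsingleton

/-- A block graph: a connected graph each of whose blocks is a complete graph. -/
def IsBlockGraph (G : SimpleGraph V) : Prop :=
  G.Connected ∧ ∀ B : Set V, IsBlock G B → B.Pairwise G.Adj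

/-- The class `Bl(k, φ)` of block graphs on `k` vertices with dissociation number `φ`. -/
def memBl (k φ : ℕ) (G : SimpleGraph (Fin k)) : Prop :=
  IsBlockGraph G ∧ dissocNum G = φ

/-- `G` has maximal spectral radius in the class `Bl(k, φ)`. -/
def MaxSpecIn (k φ : ℕ) (G : SimpleGraph (Fin k)) : Prop :=
  memBl k φ G ∧ ∀ H : SimpleGraph (Fin k), memBl k φ H → specRad H ≤ specRad G


def NS (G : SimpleGraph V) (C : Set V) : Prop :=
  (G.induce C).Connected ∧ (∀ v, ¬ IsCutVertex (G.induce C) v)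

lemma del_iff (G : SimpleGraph V) (C : Set V) (z : C) :
    ((⊤ : (G.induce C).Subgraph).deleteVerts {z}).coe.Connected ↔
      (G.induce (C \ {z.1})).Connected := by
  refine SimpleGraph.Iso.connected_iff ?_
  refine ⟨⟨fun a => ⟨a.1.1, a.1.2, ?_⟩, fun b => ⟨⟨b.1, b.2.1⟩, ?_⟩, ?_, ?_⟩, ?_⟩
  · have := a.2
    simp only [SimpleGraph.Subgraph.deleteVerts_verts] at this
    intro h
    exact this.2 (Subtype.ext h)
  · simp only [SimpleGraph.Subgraph.deleteVerts_verts]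
    refine ⟨trivial, ?_⟩
    intro h
    exact b.2.2 (congrArg Subtype.val h)
  · intro a; rfl
  · intro a; rfl
  · intro a b
    have ha := a.2
    have hb := b.2
    simp only [SimpleGraph.Subgraph.deleteVerts_verts] at ha hb
    simp only [SimpleGraph.Subgraph.deleteVerts_adj, SimpleGraph.Subgraph.coe_adj]
    exact ⟨fun h => ⟨trivial, ha.2, trivial, hb.2, h⟩, fun h => h.2.2.2.2⟩

lemma ns_iff (G : SimpleGraph V) (C : Set V) :
    NS G C ↔ (G.induce C).Connected ∧ ∀ z ∈ C, (G.induce (C \ {z})).Connected := by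
  constructor
  · rintro ⟨h1, h2⟩
    refine ⟨h1, fun z hz => ?_⟩
    have := h2 ⟨z, hz⟩
    by_contra h
    exact this ⟨h1, fun h' => h ((del_iff G C ⟨z, hz⟩).1 h')⟩
  · rintro ⟨h1, h2⟩
    refine ⟨h1, fun z hz => hz.2 ((del_iff G C z).2 (h2 z.1 z.2))⟩

lemma inv_conn {H : SimpleGraph V} {C : Set V} (hc : (H.induce C).Connected) (p : V → Prop)
    (hp : ∀ a ∈ C, ∀ b ∈ C, H.Adj a b → p a → p b) {x y : V} (hx : x ∈ C) (hy : y ∈ C)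
    (h : p x) : p y := by
  obtain ⟨w⟩ := hc.preconnected ⟨x, hx⟩ ⟨y, hy⟩
  have : ∀ (a b : C), (H.induce C).Walk a b → p a → p b := by
    intro a b w
    induction w with
    | nil => exact id
    | cons hadj _ ih => exact fun h => ih (hp _ (Subtype.coe_prop _) _ (Subtype.coe_prop _) hadj h)
  exact this _ _ w h

lemma conn_of {G : SimpleGraph V} {S K : Set V} (hK : K ⊆ S) (hcl : K.Pairwise G.Adj)
    (hne : K.Nonempty)
    (h : ∀ y ∈ S, ∃ b ∈ K, ∃ w : G.Walk y b, ∀ x ∈ w.support, x ∈ S) :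
    (G.induce S).Connected := by
  obtain ⟨k0, hk0⟩ := hne
  have key : ∀ y : S, (G.induce S).Reachable y ⟨k0, hK hk0⟩ := by
    rintro ⟨y, hy⟩
    obtain ⟨b, hb, w, hw⟩ := h y hy
    have h1 : (G.induce S).Reachable ⟨y, hy⟩ ⟨b, hK hb⟩ := ⟨w.induce S hw⟩
    refine h1.trans ?_
    by_cases hbk : b = k0
    · subst hbk; rfl
    · exact SimpleGraph.Adj.reachable (hcl hb hk0 hbk)
  haveI : Nonempty S := ⟨⟨k0, hK hk0⟩⟩
  exact ⟨fun a b => (key a).trans (key b).symm⟩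

lemma path_in_block {G : SimpleGraph V} {B : Set V} (hB : IsBlock G B) (hcl : B.Pairwise G.Adj)
    {m m' : V} (hm : m ∈ B) (hm' : m' ∈ B) (hne : m ≠ m') (w : G.Walk m m') (hw : w.IsPath) :
    ∀ x ∈ w.support, x ∈ B := by
  classical
  have hNS : NS G (B ∪ {x | x ∈ w.support}) := by
    rw [ns_iff]
    constructor
    · refine conn_of (K := B) Set.subset_union_left hcl ⟨m, hm⟩ ?_
      rintro y (hy | hy)
      · exact ⟨y, hy, .nil, by simp [hy]⟩
      · refine ⟨m', hm', w.dropUntil y hy, fun x hx => Or.inr ?_⟩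
        exact w.support_dropUntil_subset hy hx
    · intro z _
      refine conn_of (K := B \ {z}) (Set.diff_subset_diff_left Set.subset_union_left)
        (hcl.mono Set.diff_subset) ?_ ?_
      · by_cases h : m = z
        · exact ⟨m', hm', fun h' => hne (h.trans h'.symm)⟩
        · exact ⟨m, hm, h⟩
      · rintro y ⟨hy | hy, hyz⟩
        · exact ⟨y, ⟨hy, hyz⟩, .nil, by simp [hy]; exact hyz⟩
        · have hyz' : y ≠ z := hyz
          by_cases hz : z ∈ (w.takeUntil y hy).support
          · have hz2 : z ∉ (w.dropUntil y hy).support := by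
              intro hz2
              have hnd := hw.support_nodup
              rw [← w.take_spec hy, SimpleGraph.Walk.support_append] at hnd
              rw [SimpleGraph.Walk.support_eq_cons] at hz2
              rcases List.mem_cons.1 hz2 with h | h
              · exact hyz' h.symm
              · exact (List.nodup_append.1 hnd).2.2 _ hz _ h rfl
            refine ⟨m', ⟨hm', ?_⟩, w.dropUntil y hy, fun x hx => ⟨Or.inr ?_, ?_⟩⟩
            · rintro rfl; exact hz2 (SimpleGraph.Walk.end_mem_support _)
            · exact w.support_dropUntil_subset hy hx
            · rintro rfl; exact hz2 hx
          · refine ⟨m, ⟨hm, ?_⟩, (w.takeUntil y hy).reverse, fun x hx => ?_⟩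
            · rintro rfl; exact hz (SimpleGraph.Walk.start_mem_support _)
            · rw [SimpleGraph.Walk.support_reverse, List.mem_reverse] at hx
              refine ⟨Or.inr (w.support_takeUntil_subset hy hx), ?_⟩
              rintro rfl; exact hz hx
  have := hB.2.2 _ Set.subset_union_left hNS.1 hNS.2
  intro x hx
  rw [this]; exact Or.inr hx

lemma ext_block [Finite V] {G : SimpleGraph V} {C : Set V} (h : NS G C) :
    ∃ B, C ⊆ B ∧ IsBlock G B := by
  obtain ⟨B, hCB, hB⟩ := (Set.toFinite {C | NS G C}).exists_le_maximal h
  refine ⟨B, hCB, hB.1.1, hB.1.2, fun D hBD h1 h2 => ?_⟩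
  exact Set.Subset.antisymm hBD (hB.2 (show NS G D from ⟨h1, h2⟩) hBD)

lemma bg_iff [Finite V] {G : SimpleGraph V} :
    IsBlockGraph G ↔ G.Connected ∧ ∀ C, NS G C → C.Pairwise G.Adj := by
  constructor
  · rintro ⟨h1, h2⟩
    refine ⟨h1, fun C hC => ?_⟩
    obtain ⟨B, hCB, hB⟩ := ext_block hC
    exact (h2 B hB).mono hCB
  · rintro ⟨h1, h2⟩
    exact ⟨h1, fun B hB => h2 B ⟨hB.1, hB.2.1⟩⟩

lemma inter_block {G : SimpleGraph V} {B B' : Set V} (hB : IsBlock G B) (hB' : IsBlock G B')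
    (hcl : B.Pairwise G.Adj) (hcl' : B'.Pairwise G.Adj) (hne : B ≠ B') {v m : V}
    (hv : v ∈ B) (hv' : v ∈ B') (hm : m ∈ B) (hm' : m ∈ B') : m = v := by
  by_contra hmv
  apply hne
  refine (hB'.2.2 B ?_ hB.1 hB.2.1).symm
  intro b hb
  by_cases h1 : b = v
  · rwa [h1]
  by_cases h2 : b = m
  · rwa [h2]
  have e1 : G.Adj m b := hcl' hm' hb (Ne.symm h2)
  have e2 : G.Adj b v := hcl' hb hv' h1
  exact path_in_block hB hcl hm hv hmv (.cons e1 (.cons e2 .nil))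
    (by simp [SimpleGraph.Walk.cons_isPath_iff, h1, hmv, Ne.symm h2]) b (by simp)

/-- edges of `G` inside neither block -/
def rest (G : SimpleGraph V) (B B' : Set V) : SimpleGraph V where
  Adj a b := G.Adj a b ∧ ¬ (a ∈ B ∧ b ∈ B) ∧ ¬ (a ∈ B' ∧ b ∈ B')
  symm := ⟨fun a b h => ⟨h.1.symm, fun h' => h.2.1 h'.symm, fun h' => h.2.2 h'.symm⟩⟩
  loopless := ⟨fun a h => G.loopless.irrefl a h.1⟩

lemma rest_le (G : SimpleGraph V) (B B' : Set V) : rest G B B' ≤ G := fun _ _ h => h.1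

lemma rest_comm (G : SimpleGraph V) (B B' : Set V) : rest G B B' = rest G B' B := by
  ext a b; simp only [rest]; tauto

lemma rest_same {G : SimpleGraph V} {B B' : Set V} (hB : IsBlock G B)
    (hcl : B.Pairwise G.Adj) {m m' : V} (hm : m ∈ B) (hm' : m' ∈ B)
    (h : (rest G B B').Reachable m m') : m = m' := by
  classical
  by_contra hne
  obtain ⟨w⟩ := h
  have hp := w.bypass_isPath
  have hin := path_in_block hB hcl hm hm' hne (w.bypass.mapLe (rest_le G B B'))
    ((SimpleGraph.Walk.isPath_mapLe (rest_le G B B')).2 hp)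
  revert hin
  cases w.bypass with
  | nil => exact absurd rfl hne
  | cons hadj q =>
    intro hin
    exact hadj.2.1 ⟨hm, hin _ (by simp)⟩

lemma rest_unique {G : SimpleGraph V} {B B' : Set V} (hB : IsBlock G B) (hB' : IsBlock G B')
    (hcl : B.Pairwise G.Adj) (hcl' : B'.Pairwise G.Adj) (hne : B ≠ B') {v : V}
    (hv : v ∈ B) (hv' : v ∈ B') {m m' : V} (hm : m ∈ B ∪ B') (hm' : m' ∈ B ∪ B')
    (h : (rest G B B').Reachable m m') : m = m' := by
  classical
  have key : ∀ m m' : V, m ∈ B → m' ∈ B' → (rest G B B').Reachable m m' → m = m' := by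
    intro m m' hm hm' h
    by_cases hmB : m' ∈ B
    · exact rest_same hB hcl hm hmB h
    obtain ⟨w⟩ := h
    have hp := w.bypass_isPath
    by_cases hvs : v ∈ w.bypass.support
    · have h1 : (rest G B B').Reachable m v := ⟨w.bypass.takeUntil v hvs⟩
      have h2 : (rest G B' B).Reachable v m' := by
        rw [rest_comm]; exact ⟨w.bypass.dropUntil v hvs⟩
      exact (rest_same hB hcl hm hv h1).trans (rest_same hB' hcl' hv' hm' h2)
    · exfalso
      have hm'v : m' ≠ v := fun h => hmB (h ▸ hv)
      have hmv : m ≠ v := fun h => hvs (h ▸ SimpleGraph.Walk.start_mem_support _)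
      have e : G.Adj m' v := hcl' hm' hv' hm'v
      have hp' : ((w.bypass.mapLe (rest_le G B B')).concat e).IsPath := by
        rw [SimpleGraph.Walk.concat_isPath_iff]
        refine ⟨(SimpleGraph.Walk.isPath_mapLe (rest_le G B B')).2 hp, ?_⟩
        simpa using hvs
      exact hmB (path_in_block hB hcl hm hv hmv _ hp' m' (by simp))
  rcases hm with hm | hm <;> rcases hm' with hm' | hm'
  · exact rest_same hB hcl hm hm' h
  · exact key _ _ hm hm' h
  · exact (key _ _ hm' hm h.symm).symm
  · rw [rest_comm] at h; exact rest_same hB' hcl' hm hm' h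

lemma exists_retract {G : SimpleGraph V} (hG : G.Connected) {B B' : Set V} (hB : IsBlock G B)
    (hB' : IsBlock G B')
    (hcl : B.Pairwise G.Adj) (hcl' : B'.Pairwise G.Adj) (hne : B ≠ B') {v : V}
    (hv : v ∈ B) (hv' : v ∈ B') :
    ∃ r : V → V, (∀ x, r x ∈ B ∪ B') ∧ (∀ x ∈ B ∪ B', r x = x) ∧
      ∀ a b, (rest G B B').Adj a b → r a = r b := by
  have hex : ∀ x, ∃ m ∈ B ∪ B', (rest G B B').Reachable x m := by
    intro x
    obtain ⟨w⟩ := hG.preconnected x v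
    induction w with
    | nil => exact ⟨_, Or.inl hv, .refl _⟩
    | @cons a b c hadj q ih =>
      obtain ⟨m, hm, hr⟩ := ih hv hv'
      by_cases ha : a ∈ B ∪ B'
      · exact ⟨a, ha, .refl _⟩
      · refine ⟨m, hm, SimpleGraph.Reachable.trans (SimpleGraph.Adj.reachable ⟨hadj, ?_, ?_⟩) hr⟩
        · exact fun h => ha (Or.inl h.1)
        · exact fun h => ha (Or.inr h.1)
  choose r hr1 hr2 using hex
  refine ⟨r, hr1, fun x hx => ?_, fun a b h => ?_⟩
  · exact rest_unique hB hB' hcl hcl' hne hv hv' (hr1 x) hx (hr2 x).symm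
  · exact rest_unique hB hB' hcl hcl' hne hv hv' (hr1 a) (hr1 b)
      ((hr2 a).symm.trans (h.reachable.trans (hr2 b)))

/-- Move the vertices of `U` from `B'` to `B`. -/
def mv (G : SimpleGraph V) (B B' U : Set V) : SimpleGraph V where
  Adj a b := (a ≠ b ∧ ((a ∈ B ∪ U ∧ b ∈ B ∪ U) ∨ (a ∈ B' \ U ∧ b ∈ B' \ U))) ∨
    (rest G B B').Adj a b
  symm := ⟨fun a b h => by
    rcases h with ⟨h1, h2⟩ | h
    · exact Or.inl ⟨h1.symm, h2.imp And.symm And.symm⟩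
    · exact Or.inr h.symm⟩
  loopless := ⟨fun a h => by
    rcases h with ⟨h1, _⟩ | h
    · exact h1 rfl
    · exact (rest G B B').loopless.irrefl a h⟩

lemma mv_connected {G : SimpleGraph V} (hG : G.Connected) {B B' U : Set V} {v : V}
    (hv : v ∈ B) (hv' : v ∈ B') (hU : U ⊆ B' \ {v}) : (mv G B B' U).Connected := by
  have hvU : v ∉ U := fun h => (hU h).2 rfl
  have key : ∀ a ∈ B ∪ B', (mv G B B' U).Reachable a v := by
    intro a ha
    by_cases hav : a = v
    · subst hav; rfl
    refine SimpleGraph.Adj.reachable (Or.inl ⟨hav, ?_⟩)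
    by_cases haU : a ∈ U
    · exact Or.inl ⟨Or.inr haU, Or.inl hv⟩
    · rcases ha with ha | ha
      · exact Or.inl ⟨Or.inl ha, Or.inl hv⟩
      · exact Or.inr ⟨⟨ha, haU⟩, hv', hvU⟩
  haveI := hG.nonempty
  refine ⟨fun a b => ?_⟩
  obtain ⟨w⟩ := hG.preconnected a b
  clear hG
  induction w with
  | nil => rfl
  | @cons a b c hadj q ih =>
    refine SimpleGraph.Reachable.trans ?_ ih
    by_cases h1 : a ∈ B ∧ b ∈ B
    · exact (key _ (Or.inl h1.1)).trans (key _ (Or.inl h1.2)).symm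
    by_cases h2 : a ∈ B' ∧ b ∈ B'
    · exact (key _ (Or.inr h2.1)).trans (key _ (Or.inr h2.2)).symm
    exact SimpleGraph.Adj.reachable (Or.inr ⟨hadj, h1, h2⟩)

lemma induce_congr {G H : SimpleGraph V} {C : Set V}
    (h : ∀ a ∈ C, ∀ b ∈ C, (H.Adj a b ↔ G.Adj a b)) : H.induce C = G.induce C := by
  ext a b
  exact h a.1 a.2 b.1 b.2

lemma ns_congr {G H : SimpleGraph V} {C : Set V}
    (h : ∀ a ∈ C, ∀ b ∈ C, (H.Adj a b ↔ G.Adj a b)) (hC : NS H C) : NS G C := by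
  rw [ns_iff] at hC ⊢
  rw [induce_congr h] at hC
  refine ⟨hC.1, fun z hz => ?_⟩
  have := hC.2 z hz
  rwa [induce_congr (G := G) (fun a ha b hb => h a ha.1 b hb.1)] at this

lemma ns_del {H : SimpleGraph V} {C : Set V} (hC : NS H C) (z : V) :
    (H.induce (C \ {z})).Connected := by
  rw [ns_iff] at hC
  by_cases hz : z ∈ C
  · exact hC.2 z hz
  · rw [Set.sdiff_singleton_eq_self hz]; exact hC.1

lemma mv_block [Finite V] {G : SimpleGraph V} (hG : IsBlockGraph G) {B B' U : Set V} {v : V}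
    (hB : IsBlock G B) (hB' : IsBlock G B') (hne : B ≠ B')
    (hv : v ∈ B) (hv' : v ∈ B') (hU : U ⊆ B' \ {v}) : IsBlockGraph (mv G B B' U) := by
  have hcl := hG.2 B hB
  have hcl' := hG.2 B' hB'
  obtain ⟨r, hr1, hr2, hr3⟩ := exists_retract hG.1 hB hB' hcl hcl' hne hv hv'
  have hvU : v ∉ U := fun h => (hU h).2 rfl
  have hadj : ∀ a b, (mv G B B' U).Adj a b → r a = r b ∨ (a ∈ B ∪ B' ∧ b ∈ B ∪ B') := by
    rintro a b (⟨_, h | h⟩ | h)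
    · right
      exact ⟨h.1.imp id fun h => (hU h).1, h.2.imp id fun h => (hU h).1⟩
    · exact Or.inr ⟨Or.inr h.1.1, Or.inr h.2.1⟩
    · exact Or.inl (hr3 a b h)
  rw [bg_iff]
  refine ⟨mv_connected hG.1 hv hv' hU, fun C hC => ?_⟩
  by_cases hA : ∃ x ∈ C, r x ≠ x
  · obtain ⟨x, hxC, hx⟩ := hA
    by_cases hA' : ∃ y ∈ C, r y ≠ r x
    · exfalso
      obtain ⟨y, hyC, hy⟩ := hA'
      have hyw : y ≠ r x := fun h => hy (by rw [h]; exact hr2 _ (hr1 x))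
      refine hy (inv_conn (ns_del hC (r x)) (fun a => r a = r x) ?_
        (x := x) (y := y) ⟨hxC, Ne.symm hx⟩ ⟨hyC, hyw⟩ rfl)
      intro a ha b hb hab hra
      rcases hadj a b hab with h | h
      · exact h ▸ hra
      · exact absurd ((hr2 a h.1).symm.trans hra) ha.2
    · push Not at hA'
      have hag : ∀ a ∈ C, ∀ b ∈ C, ((mv G B B' U).Adj a b ↔ G.Adj a b) := by
        intro a ha b hb
        by_cases hM : a ∈ B ∪ B' ∧ b ∈ B ∪ B'
        · have : a = b := by
            rw [← hr2 a hM.1, ← hr2 b hM.2, hA' a ha, hA' b hb]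
          subst this
          simp
        · constructor
          · rintro (⟨_, h | h⟩ | h)
            · exact absurd ⟨h.1.imp id fun h => (hU h).1, h.2.imp id fun h => (hU h).1⟩ hM
            · exact absurd ⟨Or.inr h.1.1, Or.inr h.2.1⟩ hM
            · exact h.1
          · intro h
            exact Or.inr ⟨h, fun h => hM ⟨Or.inl h.1, Or.inl h.2⟩,
              fun h => hM ⟨Or.inr h.1, Or.inr h.2⟩⟩
      have := (bg_iff.1 hG).2 C (ns_congr hag hC)
      intro a ha b hb hab
      exact (hag a ha b hb).2 (this ha hb hab)
  · push Not at hA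
    have hM : ∀ x ∈ C, x ∈ B ∪ B' := fun x hx => hA x hx ▸ hr1 x
    by_cases h1 : ∀ x ∈ C, x ∈ B ∪ U
    · intro a ha b hb hab
      exact Or.inl ⟨hab, Or.inl ⟨h1 a ha, h1 b hb⟩⟩
    by_cases h2 : ∀ x ∈ C, x ∈ B' \ U
    · intro a ha b hb hab
      exact Or.inl ⟨hab, Or.inr ⟨h2 a ha, h2 b hb⟩⟩
    exfalso
    push Not at h1 h2
    obtain ⟨x, hxC, hx⟩ := h1
    obtain ⟨y, hyC, hy⟩ := h2
    have hxv : x ≠ v := fun h => hx (h ▸ Or.inl hv)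
    have hyv : y ≠ v := fun h => hy (h ▸ ⟨hv', hvU⟩)
    have hyP : y ∈ B ∪ U := by
      rcases hM y hyC with h | h
      · exact Or.inl h
      · by_contra hcon
        exact hy ⟨h, fun h' => hcon (Or.inr h')⟩
    refine hx (inv_conn (ns_del hC v) (fun a => a ∈ B ∪ U) ?_
        (x := y) (y := x) ⟨hyC, hyv⟩ ⟨hxC, hxv⟩ hyP)
    rintro a ha b hb (⟨_, h | h⟩ | h) hap
    · exact h.2
    · rcases hap with hap | hap
      · exact absurd (inter_block hB hB' hcl hcl' hne hv hv' hap h.1.1) ha.2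
      · exact absurd hap h.1.2
    · have := hr3 a b h
      rw [hA a ha.1, hA b hb.1] at this
      exact this ▸ hap

lemma dissoc_mono [Finite V] {G H : SimpleGraph V} {D E : Set V} (hD : IsDissoc G D) (hE : E ⊆ D)
    (h : ∀ a ∈ E, ∀ b ∈ E, H.Adj a b → G.Adj a b) : IsDissoc H E := by
  intro a ha
  refine le_trans (Set.ncard_le_ncard ?_ (Set.toFinite _)) (hD a (hE ha))
  rintro b ⟨hb, hab⟩
  exact ⟨hE hb, h a ha b hb hab⟩

lemma bdd_dissoc [Fintype V] (G : SimpleGraph V) :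
    BddAbove {n : ℕ | ∃ D : Set V, IsDissoc G D ∧ D.ncard = n} := by
  refine ⟨Nat.card V, ?_⟩
  rintro n ⟨D, _, rfl⟩
  exact Set.ncard_le_card D

lemma le_dissocNum [Fintype V] {G : SimpleGraph V} {D : Set V} (hD : IsDissoc G D) :
    D.ncard ≤ dissocNum G := le_csSup (bdd_dissoc G) ⟨D, hD, rfl⟩

lemma exists_max_dissoc [Fintype V] (G : SimpleGraph V) :
    ∃ D, IsDissoc G D ∧ D.ncard = dissocNum G :=
  Nat.sSup_mem (s := {n : ℕ | ∃ D : Set V, IsDissoc G D ∧ D.ncard = n})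
    ⟨0, ∅, fun _ h => absurd h (Set.notMem_empty _), Set.ncard_empty _⟩ (bdd_dissoc G)

lemma exists_U [Fintype V] {G : SimpleGraph V} {B B' : Set V} {v : V}
    (hcl' : B'.Pairwise G.Adj) (hcl : B.Pairwise G.Adj)
    (hv : v ∈ B) (hv' : v ∈ B') (hcard : 4 ≤ B'.ncard) :
    ∃ U ⊆ B' \ {v}, U.Nonempty ∧ dissocNum (mv G B B' U) = dissocNum G := by
  classical
  obtain ⟨D, hD, hDc⟩ := exists_max_dissoc G
  -- a vertex of B' outside D
  have hDB : (D ∩ B').ncard ≤ 2 := by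
    by_contra hcon
    push Not at hcon
    obtain ⟨d, hd⟩ : (D ∩ B').Nonempty := Set.nonempty_of_ncard_ne_zero (by omega)
    have h1 : ((D ∩ B') \ {d}).ncard ≤ 1 := by
      refine le_trans (Set.ncard_le_ncard ?_ (Set.toFinite _)) (hD d hd.1)
      rintro e ⟨he, hed⟩
      exact ⟨he.1, hcl' hd.2 he.2 (Ne.symm hed)⟩
    have h2 := Set.ncard_sdiff_singleton_add_one hd (Set.toFinite _)
    omega
  obtain ⟨u, huB, huv, huD⟩ : ∃ u ∈ B', u ≠ v ∧ u ∉ D := by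
    by_contra hcon
    push Not at hcon
    have h1 : B' \ {v} ⊆ D ∩ B' := fun e he => ⟨hcon e he.1 he.2, he.1⟩
    have h2 := Set.ncard_le_ncard h1 (Set.toFinite _)
    have h3 := Set.ncard_sdiff_singleton_add_one hv' (Set.toFinite B')
    omega
  -- the family
  have hu0 : D.ncard ≤ dissocNum (mv G B B' {u}) := by
    apply le_dissocNum
    refine dissoc_mono hD subset_rfl ?_
    rintro a ha b hb (⟨hab, h | h⟩ | h)
    · have ha' : a ≠ u := fun h => huD (h ▸ ha)
      have hb' : b ≠ u := fun h => huD (h ▸ hb)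
      exact hcl (h.1.resolve_right ha') (h.2.resolve_right hb') hab
    · exact hcl' h.1.1 h.2.1 hab
    · exact h.1
  have hsub : ({u} : Set V) ⊆ B' \ {v} := by
    rintro a rfl
    exact ⟨huB, huv⟩
  have hmemu : ({u} : Set V) ∈ {U : Set V | U ⊆ B' \ {v} ∧
      dissocNum G ≤ dissocNum (mv G B B' U)} := ⟨hsub, hDc ▸ hu0⟩
  obtain ⟨U, hUu, hU⟩ := (Set.toFinite {U : Set V | U ⊆ B' \ {v} ∧
    dissocNum G ≤ dissocNum (mv G B B' U)}).exists_le_maximal (a := {u})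
    hmemu
  refine ⟨U, hU.1.1, ⟨u, hUu rfl⟩, le_antisymm ?_ hU.1.2⟩
  by_cases hall : U = B' \ {v}
  · obtain ⟨E, hE, hEc⟩ := exists_max_dissoc (mv G B B' U)
    rw [← hEc]
    apply le_dissocNum
    refine dissoc_mono hE subset_rfl ?_
    intro a _ b _ hab
    by_cases h1 : a ∈ B ∧ b ∈ B
    · exact Or.inl ⟨hab.ne, Or.inl ⟨Or.inl h1.1, Or.inl h1.2⟩⟩
    by_cases h2 : a ∈ B' ∧ b ∈ B'
    · have key : ∀ c ∈ B', c ∈ B ∪ U := by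
        intro c hc
        by_cases hcv : c = v
        · exact Or.inl (hcv ▸ hv)
        · exact Or.inr (by rw [hall]; exact ⟨hc, hcv⟩)
      exact Or.inl ⟨hab.ne, Or.inl ⟨key a h2.1, key b h2.2⟩⟩
    exact Or.inr ⟨hab, h1, h2⟩
  · obtain ⟨w, hwB, hwU⟩ : ∃ w ∈ B' \ {v}, w ∉ U := by
      by_contra hcon
      push Not at hcon
      exact hall (Set.Subset.antisymm hU.1.1 hcon)
    have hlt : dissocNum (mv G B B' (insert w U)) < dissocNum G := by
      by_contra hcon
      push Not at hcon
      exact hwU (hU.2 (show _ ∧ _ from ⟨Set.insert_subset hwB hU.1.1, hcon⟩) (Set.subset_insert w U)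
        (Set.mem_insert w U))
    obtain ⟨E, hE, hEc⟩ := exists_max_dissoc (mv G B B' U)
    have h1 : (E \ {w}).ncard ≤ dissocNum (mv G B B' (insert w U)) := by
      apply le_dissocNum
      refine dissoc_mono hE Set.sdiff_subset ?_
      rintro a ⟨_, ha⟩ b ⟨_, hb⟩ (⟨hab, h | h⟩ | h)
      · exact Or.inl ⟨hab, Or.inl ⟨h.1.imp id fun h => h.resolve_left ha,
          h.2.imp id fun h => h.resolve_left hb⟩⟩
      · exact Or.inl ⟨hab, Or.inr ⟨⟨h.1.1, fun h' => h.1.2 (Or.inr h')⟩,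
          h.2.1, fun h' => h.2.2 (Or.inr h')⟩⟩
      · exact Or.inr h
    have h2 : E.ncard ≤ (E \ {w}).ncard + 1 := by
      have := Set.ncard_le_ncard_sdiff_add_ncard E {w} (Set.toFinite _)
      rwa [Set.ncard_singleton] at this
    omega

open Matrix in
lemma top_eig [Fintype V] [Nonempty V] (A : Matrix V V ℝ) :
    ∃ (μ : ℝ) (x : V → ℝ), x ⬝ᵥ x = 1 ∧ x ⬝ᵥ A *ᵥ x = μ ∧ ∀ y, y ⬝ᵥ A *ᵥ y ≤ μ * (y ⬝ᵥ y) := by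
  classical
  have hcomp : IsCompact {y : V → ℝ | y ⬝ᵥ y = 1} := by
    refine Metric.isCompact_of_isClosed_isBounded ?_ ?_
    · exact isClosed_eq (by unfold dotProduct; fun_prop) continuous_const
    · refine (Metric.isBounded_closedBall (x := (0 : V → ℝ)) (r := 1)).subset ?_
      intro y hy
      rw [mem_closedBall_zero_iff, pi_norm_le_iff_of_nonneg zero_le_one]
      intro i
      have h1 : y i * y i ≤ y ⬝ᵥ y :=
        Finset.single_le_sum (f := fun i => y i * y i) (fun j _ => mul_self_nonneg _)
          (Finset.mem_univ i)
      rw [hy] at h1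
      rw [Real.norm_eq_abs]
      exact abs_le_one_iff_mul_self_le_one.2 h1
  obtain ⟨i0⟩ := ‹Nonempty V›
  obtain ⟨x, hx, hmax⟩ := hcomp.exists_isMaxOn (f := fun y => y ⬝ᵥ A *ᵥ y)
    ⟨Pi.single i0 1, by simp⟩ (by unfold mulVec dotProduct; fun_prop)
  refine ⟨_, x, hx, rfl, fun y => ?_⟩
  by_cases hy : y = 0
  · subst hy; simp
  have hpos : 0 < y ⬝ᵥ y := by
    have h0 : 0 ≤ y ⬝ᵥ y := Finset.sum_nonneg fun i _ => mul_self_nonneg _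
    exact lt_of_le_of_ne h0 fun h => hy (dotProduct_self_eq_zero.1 h.symm)
  have hs := Real.mul_self_sqrt hpos.le
  set s := Real.sqrt (y ⬝ᵥ y) with hsdef
  have hs0 : 0 < s := Real.sqrt_pos.2 hpos
  have := hmax (a := s⁻¹ • y) (by
    simp only [Set.mem_ofPred_eq, smul_dotProduct, dotProduct_smul, smul_eq_mul]
    rw [← hs]; field_simp)
  simp only [mulVec_smul, smul_dotProduct, dotProduct_smul, smul_eq_mul, Set.mem_ofPred_eq] at this
  rw [← hs]
  have h2 : y ⬝ᵥ A *ᵥ y = (s * s) * (s⁻¹ * (s⁻¹ * (y ⬝ᵥ A *ᵥ y))) := by field_simp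
  rw [h2, mul_comm (x ⬝ᵥ _)]
  exact mul_le_mul_of_nonneg_left this (by positivity)

open Matrix in
lemma eig_of_eq [Fintype V] {A : Matrix V V ℝ} (hA : A.IsHermitian) {μ : ℝ}
    (h : ∀ y, y ⬝ᵥ A *ᵥ y ≤ μ * (y ⬝ᵥ y)) {x : V → ℝ} (hx : x ⬝ᵥ A *ᵥ x = μ * (x ⬝ᵥ x)) :
    A *ᵥ x = μ • x := by
  classical
  have hP : (μ • (1 : Matrix V V ℝ) - A).PosSemidef := by
    refine Matrix.PosSemidef.of_dotProduct_mulVec_nonneg ?_ ?_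
    · refine Matrix.IsHermitian.sub ?_ hA
      simp [Matrix.IsHermitian, conjTranspose_smul]
    · intro y
      have := h y
      simp only [star_trivial, sub_mulVec, smul_mulVec, one_mulVec, dotProduct_sub,
        dotProduct_smul, smul_eq_mul]
      linarith
  have := (hP.dotProduct_mulVec_zero_iff x).1 (by
    simp only [star_trivial, sub_mulVec, smul_mulVec, one_mulVec, dotProduct_sub,
        dotProduct_smul, smul_eq_mul]
    linarith)
  simp only [sub_mulVec, smul_mulVec, one_mulVec] at this
  exact (sub_eq_zero.1 this).symm

lemma adjMat_herm [Fintype V] (G : SimpleGraph V) : (adjMat G).IsHermitian := by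
  ext a b
  by_cases hab : G.Adj a b
  · simp [adjMat, Matrix.conjTranspose_apply, hab, hab.symm]
  · have hba : ¬ G.Adj b a := fun h => hab h.symm
    simp [adjMat, Matrix.conjTranspose_apply, hab, hba]

lemma adjMat_nonneg [Fintype V] (G : SimpleGraph V) (a b : V) : 0 ≤ adjMat G a b := by
  simp only [adjMat, Matrix.of_apply]; split_ifs <;> norm_num

open Matrix in
lemma specRad_spec [Fintype V] [Nonempty V] (G : SimpleGraph V) :
    (∀ y, y ⬝ᵥ (adjMat G) *ᵥ y ≤ specRad G * (y ⬝ᵥ y)) ∧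
    ∃ x : V → ℝ, (∀ i, 0 ≤ x i) ∧ x ≠ 0 ∧ (adjMat G) *ᵥ x = specRad G • x := by
  obtain ⟨μ, x, hx1, hx2, hmax⟩ := top_eig (adjMat G)
  have hz : (fun i => |x i|) ⬝ᵥ (fun i => |x i|) = 1 := by
    rw [← hx1]; simp [dotProduct, abs_mul_abs_self]
  have hz2 : (fun i => |x i|) ⬝ᵥ (adjMat G) *ᵥ (fun i => |x i|) = μ * 1 := by
    refine le_antisymm (hz ▸ hmax _) ?_
    rw [mul_one, ← hx2]
    simp only [dotProduct, mulVec]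
    refine Finset.sum_le_sum fun i _ => ?_
    rw [Finset.mul_sum, Finset.mul_sum]
    refine Finset.sum_le_sum fun j _ => ?_
    calc x i * (adjMat G i j * x j) = adjMat G i j * (x i * x j) := by ring
      _ ≤ adjMat G i j * (|x i| * |x j|) := by
        refine mul_le_mul_of_nonneg_left ?_ (adjMat_nonneg G i j)
        rw [← abs_mul]; exact le_abs_self _
      _ = _ := by ring
  have hz0 : (fun i => |x i|) ≠ 0 := by
    intro h; rw [h] at hz; simp at hz
  have heig := eig_of_eq (adjMat_herm G) hmax (hz2.trans (by rw [hz]))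
  have hs : specRad G = μ := by
    refine IsGreatest.csSup_eq ⟨⟨_, hz0, heig⟩, ?_⟩
    rintro r ⟨y, hy, hr⟩
    have h1 := hmax y
    rw [hr, dotProduct_smul, smul_eq_mul] at h1
    have hpos : 0 < y ⬝ᵥ y := by
      have h0 : 0 ≤ y ⬝ᵥ y := Finset.sum_nonneg fun i _ => mul_self_nonneg _
      exact lt_of_le_of_ne h0 fun h => hy (dotProduct_self_eq_zero.1 h.symm)
    exact le_of_mul_le_mul_right h1 hpos
  rw [hs]
  exact ⟨hmax, _, fun i => abs_nonneg _, hz0, heig⟩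

open Matrix in
lemma exists_perron [Fintype V] {G : SimpleGraph V} (hG : G.Connected) :
    ∃ x, IsPerron G x := by
  haveI := hG.nonempty
  obtain ⟨x, hx0, hxne, hx⟩ := (specRad_spec G).2
  refine ⟨x, fun v => ?_, hx⟩
  refine lt_of_le_of_ne (hx0 v) fun hv => hxne ?_
  have step : ∀ a b, G.Adj a b → x a = 0 → x b = 0 := by
    intro a b hab ha
    have h1 := congrFun hx a
    simp only [Pi.smul_apply, ha, smul_zero, mulVec, dotProduct] at h1
    have h2 := (Finset.sum_eq_zero_iff_of_nonneg
      (fun j _ => mul_nonneg (adjMat_nonneg G a j) (hx0 j))).1 h1 b (Finset.mem_univ b)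
    simpa [adjMat, hab] using h2
  funext u
  obtain ⟨w⟩ := hG.preconnected v u
  have : ∀ a b, G.Walk a b → x a = 0 → x b = 0 := by
    intro a b w
    induction w with
    | nil => exact id
    | cons h _ ih => exact fun h' => ih (step _ _ h h')
  exact this v u w hv.symm

open Matrix in
open Classical in
lemma mv_specRad [Fintype V] {G : SimpleGraph V} (hG : IsBlockGraph G) {B B' U : Set V} {v : V}
    (hB : IsBlock G B) (hB' : IsBlock G B') (hne : B ≠ B')
    (hv : v ∈ B) (hv' : v ∈ B') (hU : U ⊆ B' \ {v}) (hUne : U.Nonempty)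
    {x : V → ℝ} (hx : IsPerron G x)
    (hS : ∑ a, (if a ∈ B' then x a else 0) ≤ ∑ a, (if a ∈ B then x a else 0)) :
    specRad G < specRad (mv G B B' U) := by
  haveI := hG.1.nonempty
  have hcl := hG.2 B hB
  have hcl' := hG.2 B' hB'
  obtain ⟨r, hr1, hr2, hr3⟩ := exists_retract hG.1 hB hB' hcl hcl' hne hv hv'
  have hBB : ∀ m, m ∈ B → m ∈ B' → m = v := fun m h h' =>
    inter_block hB hB' hcl hcl' hne hv hv' h h'
  have hvU : v ∉ U := fun h => (hU h).2 rfl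
  set f : V → ℝ := fun a => if a ∈ U then 1 else 0 with hf
  set g : V → ℝ := fun a => if a ∈ B ∧ a ≠ v then 1 else 0 with hg
  set h : V → ℝ := fun a => if a ∈ B' ∧ a ≠ v ∧ a ∉ U then 1 else 0 with hh
  have hnadj : ∀ a b, a ∈ U → b ∈ B → b ≠ v → ¬ G.Adj a b := by
    intro a b ha hb hbv hab
    have haB' := (hU ha).1
    have hav : a ≠ v := (hU ha).2
    have : (rest G B B').Adj a b := ⟨hab, fun h => hav (hBB a h.1 haB'),
      fun h => hbv (hBB b hb h.2)⟩
    have h2 := hr3 a b this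
    rw [hr2 a (Or.inr haB'), hr2 b (Or.inl hb)] at h2
    exact hab.ne h2
  have hpt : ∀ a b, adjMat G a b + (f a * g b + g a * f b - f a * h b - h a * f b)
      ≤ adjMat (mv G B B' U) a b := by
    have hmono : ∀ a b, (a ∈ U → b ∈ B ∪ U) → (b ∈ U → a ∈ B ∪ U) →
        adjMat G a b ≤ adjMat (mv G B B' U) a b := by
      intro a b h1 h2
      by_cases hab : G.Adj a b
      · have : (mv G B B' U).Adj a b := by
          by_cases c1 : a ∈ B ∧ b ∈ B
          · exact Or.inl ⟨hab.ne, Or.inl ⟨Or.inl c1.1, Or.inl c1.2⟩⟩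
          by_cases c2 : a ∈ B' ∧ b ∈ B'
          · by_cases ha : a ∈ U
            · exact Or.inl ⟨hab.ne, Or.inl ⟨Or.inr ha, h1 ha⟩⟩
            by_cases hb : b ∈ U
            · exact Or.inl ⟨hab.ne, Or.inl ⟨h2 hb, Or.inr hb⟩⟩
            exact Or.inl ⟨hab.ne, Or.inr ⟨⟨c2.1, ha⟩, c2.2, hb⟩⟩
          exact Or.inr ⟨hab, c1, c2⟩
        simp [adjMat, hab, this]
      · have := adjMat_nonneg (mv G B B' U) a b
        simpa [adjMat, hab] using this
    have hone : ∀ a b, adjMat G a b ≤ 1 := by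
      intro a b; simp only [adjMat, of_apply]; split_ifs <;> norm_num
    have hsym : ∀ (K : SimpleGraph V) a b, adjMat K a b = adjMat K b a := by
      intro K a b
      by_cases hab : K.Adj a b
      · simp [adjMat, hab, hab.symm]
      · have hba : ¬ K.Adj b a := fun h => hab h.symm
        simp [adjMat, hab, hba]
    have hrow : ∀ a b, a ∈ U → adjMat G a b + (f a * g b + g a * f b - f a * h b - h a * f b)
        ≤ adjMat (mv G B B' U) a b := by
      intro a b ha
      have hav : a ≠ v := (hU ha).2
      have haB : a ∉ B := fun h => hav (hBB a h (hU ha).1)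
      have f1 : f a = 1 := by simp [hf, ha]
      have g1 : g a = 0 := by simp [hg, haB]
      have h1 : h a = 0 := by simp [hh, ha]
      rw [f1, g1, h1]
      by_cases hb : b ∈ B ∧ b ≠ v
      · have c1 : g b = 1 := by simp [hg, hb]
        have c2 : h b = 0 := by
          have : b ∉ B' := fun h => hb.2 (hBB b hb.1 h)
          simp [hh, this]
        have c3 : adjMat G a b = 0 := by simp [adjMat, hnadj a b ha hb.1 hb.2]
        have c4 : (mv G B B' U).Adj a b :=
          Or.inl ⟨fun h => haB (h ▸ hb.1), Or.inl ⟨Or.inr ha, Or.inl hb.1⟩⟩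
        have c5 : adjMat (mv G B B' U) a b = 1 := by simp [adjMat, c4]
        rw [c1, c2, c3, c5]; norm_num
      have c1 : g b = 0 := by simp only [hg, if_neg hb]
      by_cases hb2 : b ∈ B' ∧ b ≠ v ∧ b ∉ U
      · have c2 : h b = 1 := by simp only [hh, if_pos hb2]
        have c3 := adjMat_nonneg (mv G B B' U) a b
        have c4 := hone a b
        rw [c1, c2]; linarith
      · have c2 : h b = 0 := by simp only [hh, if_neg hb2]
        rw [c1, c2]
        by_cases hbP : b ∈ B ∪ U
        · have := hmono a b (fun _ => hbP) (fun _ => Or.inr ha)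
          linarith
        · have hbB' : b ∉ B' := by
            intro hbB'
            have hbv : b ≠ v := fun h => hbP (Or.inl (h ▸ hv))
            exact hb2 ⟨hbB', hbv, fun h => hbP (Or.inr h)⟩
          have hmem : ¬ (a ∈ B' ∧ b ∈ B') := fun h => hbB' h.2
          by_cases hab : G.Adj a b
          · have c4 : (mv G B B' U).Adj a b := Or.inr ⟨hab, fun h => haB h.1, hmem⟩
            simp [adjMat, hab, c4]
          · have := adjMat_nonneg (mv G B B' U) a b
            have c6 : adjMat G a b = 0 := by simp [adjMat, hab]
            rw [c6]; linarith
    intro a b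
    by_cases ha : a ∈ U
    · exact hrow a b ha
    by_cases hb : b ∈ U
    · have := hrow b a hb
      rw [hsym G a b, hsym (mv G B B' U) a b]
      linarith
    · have c1 : f a = 0 := by simp [hf, ha]
      have c2 : f b = 0 := by simp [hf, hb]
      have := hmono a b (fun h => absurd h ha) (fun h => absurd h hb)
      rw [c1, c2]; linarith
  set X := ∑ a, f a * x a with hX
  set SB := ∑ a, g a * x a with hSB
  set SQ := ∑ a, h a * x a with hSQ
  have hXpos : 0 < X := by
    obtain ⟨u, hu⟩ := hUne
    refine Finset.sum_pos' (fun a _ => mul_nonneg (by simp only [hf]; split_ifs <;> norm_num)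
      (hx.1 a).le) ⟨u, Finset.mem_univ u, ?_⟩
    simp [hf, hu, hx.1 u]
  have e1 : ∑ a, (if a ∈ B then x a else 0) = SB + x v := by
    have : x v = ∑ a, if a = v then x a else 0 := by simp
    rw [this, hSB, ← Finset.sum_add_distrib]
    refine Finset.sum_congr rfl fun a _ => ?_
    by_cases hav : a = v
    · subst hav; simp [hg, hv]
    · by_cases haB : a ∈ B <;> simp [hg, hav, haB]
  have e2 : ∑ a, (if a ∈ B' then x a else 0) = SQ + X + x v := by
    have : x v = ∑ a, if a = v then x a else 0 := by simp
    rw [this, hSQ, hX, ← Finset.sum_add_distrib, ← Finset.sum_add_distrib]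
    refine Finset.sum_congr rfl fun a _ => ?_
    by_cases hav : a = v
    · subst hav; simp [hf, hh, hv', hvU]
    · by_cases haU : a ∈ U
      · simp [hf, hh, hav, haU, (hU haU).1]
      · by_cases haB : a ∈ B' <;> simp [hf, hh, hav, haB, haU]
  have hgt : x ⬝ᵥ adjMat G *ᵥ x < x ⬝ᵥ adjMat (mv G B B' U) *ᵥ x := by
    have hsum : ∑ a, ∑ b, x a * ((adjMat G a b + (f a * g b + g a * f b - f a * h b - h a * f b))
        * x b) ≤ ∑ a, ∑ b, x a * (adjMat (mv G B B' U) a b * x b) := by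
      refine Finset.sum_le_sum fun a _ => Finset.sum_le_sum fun b _ => ?_
      exact mul_le_mul_of_nonneg_left (mul_le_mul_of_nonneg_right (hpt a b) (hx.1 b).le)
        (hx.1 a).le
    have hprod : ∀ p q : V → ℝ, (∑ a, p a * x a) * (∑ b, q b * x b) =
        ∑ a, ∑ b, x a * ((p a * q b) * x b) := by
      intro p q
      rw [Finset.sum_mul_sum]
      refine Finset.sum_congr rfl fun a _ => Finset.sum_congr rfl fun b _ => by ring
    have hexp : ∑ a, ∑ b, x a * ((adjMat G a b + (f a * g b + g a * f b - f a * h b - h a * f b))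
        * x b) = ∑ a, ∑ b, x a * (adjMat G a b * x b) + (X * SB + SB * X - X * SQ - SQ * X) := by
      rw [hX, hSB, hSQ, hprod, hprod, hprod, hprod]
      simp only [← Finset.sum_add_distrib, ← Finset.sum_sub_distrib]
      refine Finset.sum_congr rfl fun a _ => Finset.sum_congr rfl fun b _ => by ring
    have hq : ∀ A : Matrix V V ℝ, x ⬝ᵥ A *ᵥ x = ∑ a, ∑ b, x a * (A a b * x b) := by
      intro A
      simp only [dotProduct, mulVec, Finset.mul_sum]
    rw [hq, hq]
    have : 0 < X * (SB - SQ) := mul_pos hXpos (by linarith)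
    nlinarith
  have hmax := (specRad_spec (mv G B B' U)).1 x
  rw [hx.2, dotProduct_smul, smul_eq_mul] at hgt
  have h0 : 0 ≤ x ⬝ᵥ x := Finset.sum_nonneg fun i _ => mul_self_nonneg _
  exact lt_of_mul_lt_mul_right (hgt.trans_le hmax) h0

/-- In a graph with maximal spectral radius in `Bl(k,φ)`, two distinct blocks
having at least `4` vertices each are not adjacent (they share no vertex). -/
theorem big_blocks_not_adjacent (k φ : ℕ) (G : SimpleGraph (Fin k)) (hG : MaxSpecIn k φ G)
    (B B' : Set (Fin k)) (hB : IsBlock G B) (hB' : IsBlock G B')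
    (hBcard : 4 ≤ B.ncard) (hB'card : 4 ≤ B'.ncard) (hne : B ≠ B') :
    B ∩ B' = ∅ := by
  classical
  by_contra hcon
  obtain ⟨v, hv, hv'⟩ := Set.nonempty_iff_ne_empty.2 hcon
  obtain ⟨⟨hbg, hφ⟩, hmax⟩ := hG
  obtain ⟨x, hx⟩ := exists_perron hbg.1
  have main : ∀ B B' : Set (Fin k), IsBlock G B → IsBlock G B' → 4 ≤ B'.ncard → B ≠ B' →
      v ∈ B → v ∈ B' →
      ∑ a, (if a ∈ B' then x a else 0) ≤ ∑ a, (if a ∈ B then x a else 0) → False := by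
    intro B B' hB hB' hc hne hv hv' hS
    obtain ⟨U, hU, hUne, hUφ⟩ := exists_U (hbg.2 B' hB') (hbg.2 B hB) hv hv' hc
    have h1 := hmax (mv G B B' U) ⟨mv_block hbg hB hB' hne hv hv' hU, hUφ.trans hφ⟩
    have h2 := mv_specRad hbg hB hB' hne hv hv' hU hUne hx hS
    exact absurd h1 (not_le.2 h2)
  rcases le_total (∑ a, (if a ∈ B' then x a else 0)) (∑ a, (if a ∈ B then x a else 0)) with h | h
  · exact main B B' hB hB' hB'card hne hv hv' h
  · exact main B' B hB' hB hBcard hne.symm hv' hv h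

end SpectralBlock
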